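/- For every r ≥ 1, the group (F₂)^r embeds into SL_{2r}(ℂ) and into SL_{2r+1}(ℂ), while (F₂)^{r+1} embeds into neither; that is, ν(SL_{2r}(ℂ)) = ν(SL_{2r+1}(ℂ)) = r. -/

import Mathlib

/-- `FreeTorusEmbeds n G` means the direct product of `n` copies of the free group on two
generators embeds into `G`. -/
def FreeTorusEmbeds (n : ℕ) (G : Type*) [Group G] : Prop :=
  ∃ f : (Fin n → FreeGroup (Fin 2)) →* G, Function.Injective f

/-- The free subgroup rank of `G`: the maximal `n` such that `(F₂)^n` embeds into `G`. -/
noncomputable def freeSubgroupRank (G : Type*) [Group G] : ℕ∞ :=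
  sSup {c : ℕ∞ | ∃ n : ℕ, c = n ∧ FreeTorusEmbeds n G}

section
open Module

variable {G : Type} [Group G]

/-- solvable-image condition -/
def Solv {V : Type} [AddCommGroup V] [Module ℂ V] (ρ : G →* Module.End ℂ V) : Prop :=
  ∃ k, ∀ h ∈ derivedSeries G k, ρ h = 1

def subRep {V : Type} [AddCommGroup V] [Module ℂ V] (ρ : G →* Module.End ℂ V)
    (W : Submodule ℂ V) (hW : ∀ g, ∀ v ∈ W, ρ g v ∈ W) : G →* Module.End ℂ W where
  toFun g := (ρ g).restrict (hW g)
  map_one' := by ext; simp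
  map_mul' a b := by ext; simp

def quoRep {V : Type} [AddCommGroup V] [Module ℂ V] (ρ : G →* Module.End ℂ V)
    (W : Submodule ℂ V) (hW : ∀ g, ∀ v ∈ W, ρ g v ∈ W) : G →* Module.End ℂ (V ⧸ W) where
  toFun g := W.mapQ W (ρ g) (hW g)
  map_one' := by ext; simp
  map_mul' a b := by ext; simp

theorem solv_ext {V : Type} [AddCommGroup V] [Module ℂ V] (ρ : G →* Module.End ℂ V)
    (W : Submodule ℂ V) (hW : ∀ g, ∀ v ∈ W, ρ g v ∈ W)
    (h1 : Solv (subRep ρ W hW)) (h2 : Solv (quoRep ρ W hW)) : Solv ρ := by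
  obtain ⟨k, hk⟩ := h1
  obtain ⟨l, hl⟩ := h2
  have A : ∀ h ∈ derivedSeries G (max k l), (∀ w ∈ W, ρ h w = w) ∧ ∀ v, ρ h v - v ∈ W := by
    intro h hh
    constructor
    · intro w hw
      have := hk h (derivedSeries_antitone G (le_max_left k l) hh)
      have := LinearMap.congr_fun this ⟨w, hw⟩
      simpa [subRep, Subtype.ext_iff] using this
    · intro v
      have := hl h (derivedSeries_antitone G (le_max_right k l) hh)
      have := LinearMap.congr_fun this (W.mkQ v)
      rw [← Submodule.Quotient.eq]
      simpa [quoRep] using this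
  refine ⟨max k l + 1, fun h hh => ?_⟩
  have : derivedSeries G (max k l + 1) ≤ ρ.ker := by
    rw [derivedSeries_succ, Subgroup.commutator_le]
    intro a ha b hb
    rw [MonoidHom.mem_ker]
    have hc : ρ (a * b) = ρ (b * a) := by
      ext v
      have e1 := (A a ha).1 _ ((A b hb).2 v)
      have e2 := (A b hb).1 _ ((A a ha).2 v)
      rw [map_sub] at e1 e2
      simp only [map_mul, Module.End.mul_apply]
      rw [sub_eq_iff_eq_add] at e1 e2
      rw [e1, e2]; abel
    rw [commutatorElement_def, show a * b * a⁻¹ * b⁻¹ = a * b * (b * a)⁻¹ by simp [mul_assoc], map_mul, hc, ← map_mul, mul_inv_cancel, map_one]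
  exact this hh

theorem not_scalar {V : Type} [AddCommGroup V] [Module ℂ V] (ρ : G →* Module.End ℂ V)
    (h : ¬ Solv ρ) : ∃ g, ∀ c : ℂ, ρ g ≠ c • 1 := by
  by_contra! H
  apply h
  refine ⟨1, fun x hx => ?_⟩
  have : derivedSeries G 1 ≤ ρ.ker := by
    rw [derivedSeries_one, commutator_def, Subgroup.commutator_le]
    intro a _ b _
    rw [MonoidHom.mem_ker]
    have hc : ρ (a * b) = ρ (b * a) := by
      obtain ⟨c, hc⟩ := H a
      rw [map_mul, map_mul, hc]; ext; simp
    rw [commutatorElement_def, show a * b * a⁻¹ * b⁻¹ = a * b * (b * a)⁻¹ by simp [mul_assoc], map_mul, hc, ← map_mul, mul_inv_cancel, map_one]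
  exact this hx

theorem main_bound : ∀ (d : ℕ) (V : Type) [AddCommGroup V] [Module ℂ V] [FiniteDimensional ℂ V]
    (_ : finrank ℂ V = d) (ι : Type) [Fintype ι] (ρ : ι → G →* Module.End ℂ V)
    (_ : ∀ i j, i ≠ j → ∀ g h v, ρ i g (ρ j h v) = ρ j h (ρ i g v))
    (_ : ∀ i, ¬ Solv (ρ i)), 2 * Fintype.card ι ≤ d := by
  classical
  intro d
  induction d using Nat.strong_induction_on with
  | _ d ih =>
  intro V _ _ _ hd ι _ ρ hc hs
  by_cases hred : ∃ W : Submodule ℂ V, W ≠ ⊥ ∧ W ≠ ⊤ ∧ ∀ i g, ∀ v ∈ W, ρ i g v ∈ W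
  · obtain ⟨W, hb, ht, hW⟩ := hred
    have hlt := Submodule.finrank_lt ht
    have hadd := W.finrank_quotient_add_finrank
    have hpos : 0 < finrank ℂ W := by
      rw [Nat.pos_iff_ne_zero]; intro h; exact hb (Submodule.finrank_eq_zero.1 h)
    have i1 := ih (finrank ℂ W) (by omega) W rfl {i // ¬ Solv (subRep (ρ i) W (hW i))}
      (fun i => subRep (ρ i) W (hW i))
      (by
        intro i j hij g h v
        apply Subtype.ext
        simpa [subRep] using hc i j (fun e => hij (Subtype.ext e)) g h v)
      (fun i => i.2)
    have i2 := ih (finrank ℂ (V ⧸ W)) (by omega) (V ⧸ W) rfl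
      {i // ¬ Solv (quoRep (ρ i) W (hW i))}
      (fun i => quoRep (ρ i) W (hW i))
      (by
        intro i j hij g h v
        obtain ⟨v, rfl⟩ := W.mkQ_surjective v
        simp [quoRep, hc i j (fun e => hij (Subtype.ext e)) g h v])
      (fun i => i.2)
    have i3 := Fintype.card_subtype_or (fun i => ¬ Solv (subRep (ρ i) W (hW i)))
      (fun i => ¬ Solv (quoRep (ρ i) W (hW i)))
    have i4 : Fintype.card {i // ¬ Solv (subRep (ρ i) W (hW i)) ∨ ¬ Solv (quoRep (ρ i) W (hW i))}
        = Fintype.card ι := by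
      rw [Fintype.card_subtype, Finset.filter_true_of_mem, Finset.card_univ]
      intro i _
      by_contra! h
      exact hs i (solv_ext _ _ _ h.1 h.2)
    omega
  · have irr : ∀ W : Submodule ℂ V, (∀ i g, ∀ v ∈ W, ρ i g v ∈ W) → W ≠ ⊥ → W = ⊤ := by
      intro W h1 h2
      by_contra h3
      exact hred ⟨W, h2, h3, h1⟩
    rcases isEmpty_or_nonempty ι with he | ⟨⟨i0⟩⟩
    · simp
    obtain ⟨g, hg⟩ := not_scalar (ρ i0) (hs i0)
    have hnt : Nontrivial V := by
      by_contra h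
      rw [not_nontrivial_iff_subsingleton] at h
      exact hg 0 (by ext v; exact Subsingleton.elim _ _)
    obtain ⟨c, hcv⟩ := Module.End.exists_eigenvalue (ρ i0 g)
    set E := Module.End.eigenspace (ρ i0 g) c with hE
    have hb : E ≠ ⊥ := hcv
    have ht : E ≠ ⊤ := by
      intro h
      apply hg c
      ext v
      have : v ∈ E := by rw [h]; trivial
      simpa [hE, Module.End.mem_eigenspace_iff] using this
    have hlt := Submodule.finrank_lt ht
    have hadd := E.finrank_quotient_add_finrank
    have hpos : 0 < finrank ℂ E := by
      rw [Nat.pos_iff_ne_zero]; intro h; exact hb (Submodule.finrank_eq_zero.1 h)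
    have hEi : ∀ i : {i // i ≠ i0}, ∀ g, ∀ v ∈ E, ρ i g v ∈ E := by
      intro i h v hv
      rw [hE, Module.End.mem_eigenspace_iff] at hv ⊢
      rw [hc i0 i i.2.symm, hv, map_smul]
    have hconj : ∀ i (a b : G) v, ρ i a (ρ i b v) = ρ i (a * b * a⁻¹) (ρ i a v) := by
      intro i a b v
      rw [← Module.End.mul_apply, ← Module.End.mul_apply, ← map_mul, ← map_mul]
      simp
    have i1 := ih (finrank ℂ E) (by omega) E rfl {i // i ≠ i0}
      (fun i => subRep (ρ i) E (hEi i))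
      (by
        intro i j hij g h v
        apply Subtype.ext
        simpa [subRep] using hc i j (fun e => hij (Subtype.ext e)) g h v)
      (by
        rintro i ⟨k, hk⟩
        apply hs i
        refine ⟨k, fun h hh => ?_⟩
        let W : Submodule ℂ V := ⨅ h ∈ derivedSeries G k, LinearMap.ker (ρ i h - 1)
        have mW : ∀ v, v ∈ W ↔ ∀ h ∈ derivedSeries G k, ρ i h v = v := by
          intro v; simp [W, Submodule.mem_iInf, sub_eq_zero]
        have hle : E ≤ W := by
          intro v hv
          rw [mW]
          intro h hh
          have := LinearMap.congr_fun (hk h hh) ⟨v, hv⟩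
          simpa [subRep, Subtype.ext_iff] using this
        have hW : W = ⊤ := by
          apply irr
          · intro j a v hv
            rw [mW] at hv ⊢
            intro h hh
            by_cases hj : j = i
            · subst hj
              have e := hconj i a (a⁻¹ * h * a) v
              have := hv (a⁻¹ * h * a) (by
                simpa using (derivedSeries_normal G k).conj_mem h hh a⁻¹)
              rw [this] at e
              rw [show a * (a⁻¹ * h * a) * a⁻¹ = h by group] at e
              exact e.symm
            · rw [hc i j (Ne.symm hj), hv h hh]
          · intro h; rw [h, le_bot_iff] at hle; exact hb hle
        ext v
        have : v ∈ W := by rw [hW]; trivial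
        exact (mW v).1 this h hh)
    have i2 := ih (finrank ℂ (V ⧸ E)) (by omega) (V ⧸ E) rfl {i // i ≠ i0}
      (fun i => quoRep (ρ i) E (hEi i))
      (by
        intro i j hij g h v
        obtain ⟨v, rfl⟩ := E.mkQ_surjective v
        simp [quoRep, hc i j (fun e => hij (Subtype.ext e)) g h v])
      (by
        rintro i ⟨k, hk⟩
        apply hs i
        refine ⟨k, fun h hh => ?_⟩
        let W : Submodule ℂ V := Submodule.span ℂ
          {x | ∃ h ∈ derivedSeries G k, ∃ v, x = ρ i h v - v}
        have hle : W ≤ E := by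
          rw [Submodule.span_le]
          rintro x ⟨h, hh, v, rfl⟩
          have := LinearMap.congr_fun (hk h hh) (E.mkQ v)
          rw [SetLike.mem_coe, ← Submodule.Quotient.eq]
          simpa [quoRep] using this
        have hW : W = ⊥ := by
          by_contra hne
          have := irr W (by
            intro j a v hv
            have : W ≤ W.comap (ρ j a) := by
              rw [Submodule.span_le]
              rintro x ⟨h, hh, v, rfl⟩
              rw [SetLike.mem_coe, Submodule.mem_comap, map_sub]
              apply Submodule.subset_span
              by_cases hj : j = i
              · subst hj
                exact ⟨a * h * a⁻¹, (derivedSeries_normal G k).conj_mem h hh a, ρ i a v, by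
                  rw [hconj]⟩
              · exact ⟨h, hh, ρ j a v, by rw [hc j i hj]⟩
            exact this hv) hne
          rw [this, top_le_iff] at hle
          exact ht hle
        ext v
        have : ρ i h v - v ∈ W := Submodule.subset_span ⟨h, hh, v, rfl⟩
        rw [hW, Submodule.mem_bot, sub_eq_zero] at this
        exact this)
    have hcard : Fintype.card {i // i ≠ i0} + 1 = Fintype.card ι := by
      have := Fintype.card_subtype_compl (fun i => i = i0)
      have h1 : 0 < Fintype.card ι := Fintype.card_pos_iff.2 ⟨i0⟩
      simp at this ⊢
      omega
    omega

end

theorem fg_not_solv : ¬ Group.IsSolvable (FreeGroup (Fin 2)) := by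
  intro h
  let σ : Equiv.Perm (Fin 5) := finRotate 5
  let f : FreeGroup (Fin 2) →* Equiv.Perm (Fin 5) := FreeGroup.lift ![σ, Equiv.swap 0 (σ 0)]
  have hf : Function.Surjective f := by
    rw [← MonoidHom.range_eq_top, eq_top_iff,
      ← Equiv.Perm.closure_cycle_adjacent_swap (σ := σ) isCycle_finRotate support_finRotate 0,
      Subgroup.closure_le]
    rintro x (rfl | rfl)
    · exact ⟨FreeGroup.of 0, by simp [f]⟩
    · exact ⟨FreeGroup.of 1, by simp [f]⟩
  exact Equiv.Perm.not_isSolvable_fin_5 (Group.isSolvable_of_surjective hf)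

theorem upper (n d : ℕ) (f : (Fin n → FreeGroup (Fin 2)) →* Matrix.SpecialLinearGroup (Fin d) ℂ)
    (hf : Function.Injective f) : 2 * n ≤ d := by
  let φ : Matrix.SpecialLinearGroup (Fin d) ℂ →* Module.End ℂ (Fin d → ℂ) :=
    { toFun := fun A => Matrix.toLin' (A : Matrix (Fin d) (Fin d) ℂ)
      map_one' := by simp [Module.End.one_eq_id]
      map_mul' := fun A B => by
        rw [Matrix.SpecialLinearGroup.coe_mul, Matrix.toLin'_mul]; rfl }
  have hφ : Function.Injective φ := fun A B h => Subtype.ext (Matrix.toLin'.injective h)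
  let s : ∀ _ : Fin n, FreeGroup (Fin 2) →* (Fin n → FreeGroup (Fin 2)) :=
    fun i => MonoidHom.mulSingle (fun _ => FreeGroup (Fin 2)) i
  have := main_bound (G := FreeGroup (Fin 2)) d (Fin d → ℂ) (by simp) (Fin n)
    (fun i => φ.comp (f.comp (s i)))
    (by
      intro i j hij g h v
      have : Commute (s i g) (s j h) := 
        Pi.mulSingle_commute (f := fun _ : Fin n => FreeGroup (Fin 2)) hij g h
      have := (this.map f).map φ
      exact LinearMap.congr_fun this v)
    (by
      rintro i ⟨k, hk⟩
      apply fg_not_solv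
      refine ⟨⟨k, ?_⟩⟩
      rw [eq_bot_iff]
      intro h hh
      have h1 := hk h hh
      have h2 : s i h = 1 := by
        apply hf; apply hφ
        rw [map_one, map_one]; exact h1
      rw [Subgroup.mem_bot]
      simpa [s] using h2)
  simpa using this

open UpperHalfPlane in
theorem free_SL2R : ∃ f : FreeGroup (Fin 2) →* Matrix.SpecialLinearGroup (Fin 2) ℝ,
    Function.Injective f := by
  let A : Matrix.SpecialLinearGroup (Fin 2) ℝ := ⟨!![1, 2; 0, 1], by simp⟩
  let B : Matrix.SpecialLinearGroup (Fin 2) ℝ := ⟨!![0, -1; 1, 0], by simp⟩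
  have hA : ∀ z : ℍ, (A • z).re = z.re + 2 := by
    intro z
    have := congrArg Complex.re (coe_specialLinearGroup_apply A z)
    simpa [A] using this
  have hA' : ∀ z : ℍ, (A⁻¹ • z).re = z.re - 2 := by
    intro z
    have := hA (A⁻¹ • z)
    rw [smul_inv_smul] at this
    linarith
  have hB : ∀ z : ℍ, (B • z).re * (z.re ^ 2 + z.im ^ 2) = - z.re := by
    intro z
    have := congrArg Complex.re (coe_specialLinearGroup_apply B z)
    have h2 : (B • z).re = - z.re / (z.re ^ 2 + z.im ^ 2) := by
      simp [B, Complex.div_re, Complex.normSq_apply] at this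
      rw [this]; ring
    have := z.im_pos
    rw [h2]; field_simp
  let X : Fin 2 → Set ℍ := ![{z | 1 ≤ z.re}, {z | 1 ≤ (B • z).re}]
  let Y : Fin 2 → Set ℍ := ![{z | z.re < -1}, {z | (B • z).re < -1}]
  have d1 : ∀ z : ℍ, 1 ≤ (B • z).re → -1 < z.re ∧ z.re < 1 := by
    intro z h
    have := hB z
    have := z.im_pos
    constructor <;> nlinarith
  have d2 : ∀ z : ℍ, (B • z).re < -1 → -1 < z.re ∧ z.re < 1 := by
    intro z h
    have := hB z
    have := z.im_pos
    constructor <;> nlinarith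
  refine ⟨FreeGroup.lift ![A, B⁻¹ * A * B], ?_⟩
  apply FreeGroup.injective_lift_of_ping_pong (α := ℍ) _ X Y
  · intro i
    fin_cases i
    · exact ⟨A • I, by change 1 ≤ (A • I).re; rw [hA]; simp⟩
    · refine ⟨B⁻¹ • A • I, ?_⟩
      change 1 ≤ (B • B⁻¹ • A • I).re
      rw [smul_inv_smul, hA]; simp
  · intro i j hij
    refine Set.disjoint_left.2 fun z h1 h2 => ?_
    fin_cases i <;> fin_cases j
    · exact hij rfl
    · have h1 : 1 ≤ z.re := h1
      have := d1 z h2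
      linarith
    · have h2 : 1 ≤ z.re := h2
      have := d1 z h1
      linarith
    · exact hij rfl
  · intro i j hij
    refine Set.disjoint_left.2 fun z h1 h2 => ?_
    fin_cases i <;> fin_cases j
    · exact hij rfl
    · have h1 : z.re < -1 := h1
      have := d2 z h2
      linarith
    · have h2 : z.re < -1 := h2
      have := d2 z h1
      linarith
    · exact hij rfl
  · intro i j
    refine Set.disjoint_left.2 fun z h1 h2 => ?_
    fin_cases i <;> fin_cases j
    · have h1 : 1 ≤ z.re := h1
      have h2 : z.re < -1 := h2
      linarith
    · have h1 : 1 ≤ z.re := h1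
      have := d2 z h2
      linarith
    · have h2 : z.re < -1 := h2
      have := d1 z h1
      linarith
    · have h1 : 1 ≤ (B • z).re := h1
      have h2 : (B • z).re < -1 := h2
      linarith
  · intro i
    rintro _ ⟨z, hz, rfl⟩
    fin_cases i
    · have hz : ¬ z.re < -1 := hz
      change 1 ≤ (A • z).re
      rw [hA]; linarith
    · have hz : ¬ (B • z).re < -1 := hz
      change 1 ≤ (B • (B⁻¹ * A * B) • z).re
      rw [mul_smul, mul_smul, smul_inv_smul, hA]; linarith
  · intro i
    rintro _ ⟨z, hz, rfl⟩
    fin_cases i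
    · have hz : ¬ 1 ≤ z.re := hz
      change (A⁻¹ • z).re < -1
      rw [hA']; linarith
    · have hz : ¬ 1 ≤ (B • z).re := hz
      change (B • (B⁻¹ * A * B)⁻¹ • z).re < -1
      have : (B⁻¹ * A * B)⁻¹ = B⁻¹ * A⁻¹ * B := by group
      rw [this, mul_smul, mul_smul, smul_inv_smul, hA']; linarith

theorem SL_of_hom {m n : Type} [Fintype m] [DecidableEq m] [Fintype n] [DecidableEq n]
    {H : Type} [Group H] (φ : H →* Matrix n n ℂ) (hφ : Function.Injective φ)
    (hd : ∀ h, (φ h).det = 1) (e : n ≃ m) :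
    ∃ f : H →* Matrix.SpecialLinearGroup m ℂ, Function.Injective f := by
  refine ⟨{ toFun := fun h => ⟨Matrix.reindex e e (φ h), by
              rw [Matrix.det_reindex_self, hd]⟩
            map_one' := by
              apply Subtype.ext
              change Matrix.reindex e e (φ 1) = 1
              simp
            map_mul' := fun a b => by
              apply Subtype.ext
              change Matrix.reindex e e (φ (a * b)) =
                Matrix.reindex e e (φ a) * Matrix.reindex e e (φ b)
              simp [Matrix.submatrix_mul_equiv] }, ?_⟩
  intro a b h
  apply hφ
  exact (Matrix.reindex e e).injective (congrArg Subtype.val h)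

theorem lower_hom (r : ℕ) : ∃ φ : (Fin r → FreeGroup (Fin 2)) →* Matrix (Fin 2 × Fin r) (Fin 2 × Fin r) ℂ,
    Function.Injective φ ∧ ∀ h, (φ h).det = 1 := by
  obtain ⟨f, hf⟩ := free_SL2R
  let g : FreeGroup (Fin 2) →* Matrix.SpecialLinearGroup (Fin 2) ℂ :=
    (Matrix.SpecialLinearGroup.map (algebraMap ℝ ℂ)).comp f
  have hg : Function.Injective g := by
    intro a b h
    apply hf
    ext i j
    have := congrArg (fun M : Matrix.SpecialLinearGroup (Fin 2) ℂ => M i j) h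
    simpa [g] using this
  refine ⟨{ toFun := fun h => Matrix.blockDiagonal (fun i => (g (h i) : Matrix (Fin 2) (Fin 2) ℂ))
            map_one' := by
              simp only [Pi.one_apply, map_one, Matrix.SpecialLinearGroup.coe_one]
              exact Matrix.blockDiagonal_one
            map_mul' := fun a b => by
              simp only [Pi.mul_apply, map_mul, Matrix.SpecialLinearGroup.coe_mul]
              exact Matrix.blockDiagonal_mul _ _ }, ?_, ?_⟩
  · intro a b h
    have h' : Matrix.blockDiagonal (fun i => (g (a i) : Matrix (Fin 2) (Fin 2) ℂ)) =
      Matrix.blockDiagonal (fun i => (g (b i) : Matrix (Fin 2) (Fin 2) ℂ)) := h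
    have := Matrix.blockDiagonal_injective h'
    funext i
    exact hg (Subtype.ext (congrFun this i))
  · intro h
    simp [Matrix.det_blockDiagonal]

theorem lower_even (r : ℕ) : FreeTorusEmbeds r (Matrix.SpecialLinearGroup (Fin (2 * r)) ℂ) := by
  obtain ⟨φ, h1, h2⟩ := lower_hom r
  exact SL_of_hom φ h1 h2 finProdFinEquiv

theorem lower_odd (r : ℕ) : FreeTorusEmbeds r (Matrix.SpecialLinearGroup (Fin (2 * r + 1)) ℂ) := by
  obtain ⟨φ, h1, h2⟩ := lower_hom r
  refine SL_of_hom (n := (Fin 2 × Fin r) ⊕ Fin 1)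
    { toFun := fun h => Matrix.fromBlocks (φ h) 0 0 1
      map_one' := by simp
      map_mul' := fun a b => by simp [Matrix.fromBlocks_multiply] } ?_ ?_
    ((Equiv.sumCongr finProdFinEquiv (Equiv.refl _)).trans finSumFinEquiv)
  · intro a b h
    exact h1 (Matrix.fromBlocks_inj.1 h).1
  · intro h
    simp [h2]

theorem rank_eq (r d : ℕ) (hd : d < 2 * (r + 1))
    (h : FreeTorusEmbeds r (Matrix.SpecialLinearGroup (Fin d) ℂ)) :
    freeSubgroupRank (Matrix.SpecialLinearGroup (Fin d) ℂ) = (r : ℕ∞) := by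
  apply le_antisymm
  · apply sSup_le
    rintro c ⟨n, rfl, f, hf⟩
    have := upper n d f hf
    exact_mod_cast (by omega : n ≤ r)
  · exact le_sSup ⟨r, rfl, h⟩

theorem free_subgroup_rank_of_SL_complex (r : ℕ) (hr : 1 ≤ r) :
    FreeTorusEmbeds r (Matrix.SpecialLinearGroup (Fin (2 * r)) ℂ) ∧
    FreeTorusEmbeds r (Matrix.SpecialLinearGroup (Fin (2 * r + 1)) ℂ) ∧
    ¬ FreeTorusEmbeds (r + 1) (Matrix.SpecialLinearGroup (Fin (2 * r)) ℂ) ∧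
    ¬ FreeTorusEmbeds (r + 1) (Matrix.SpecialLinearGroup (Fin (2 * r + 1)) ℂ) ∧
    freeSubgroupRank (Matrix.SpecialLinearGroup (Fin (2 * r)) ℂ) = (r : ℕ∞) ∧
    freeSubgroupRank (Matrix.SpecialLinearGroup (Fin (2 * r + 1)) ℂ) = (r : ℕ∞) := by
  refine ⟨lower_even r, lower_odd r, ?_, ?_, rank_eq _ _ (by omega) (lower_even r),
    rank_eq _ _ (by omega) (lower_odd r)⟩
  · rintro ⟨f, hf⟩
    have := upper _ _ f hf
    omega
  · rintro ⟨f, hf⟩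
    have := upper _ _ f hf
    omega
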